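/- (Convergence of the scaled outputs to the limit output.) Let σ₀ > 0 and σ₁ > 0 be constants, let g : ℝ → ℝ be continuous with g(ν) > 0 for all ν ∈ ℝ, let f : ℝ → ℝ be continuous with f(0) = 0, let u : [0,∞) → ℝ be absolutely continuous with u and u̇ essentially bounded, and let x₀ ∈ ℝ. For each γ > 0 let z_γ : [0,∞) → ℝ satisfy z_γ(t) = x₀ + ∫₀ᵗ [ −σ₀ |u̇(τ)| / g(u̇(τ)/γ) · z_γ(τ) + u̇(τ) ] dτ for all t ≥ 0, and define y_γ(t) = σ₀ z_γ(t) + (σ₁/γ) ( −σ₀ |u̇(t)| / g(u̇(t)/γ) · z_γ(t) + u̇(t) ) + f(u̇(t)/γ) for almost all t ≥ 0. Define y*_u(t) = σ₀ e^{−(σ₀/g(0)) ρ_u(t)} ( x₀ + ∫₀ᵗ e^{(σ₀/g(0)) ρ_u(τ)} u̇(τ) dτ ), where ρ_u(t) = ∫₀ᵗ |u̇(τ)| dτ. Then the essential supremum over t ∈ [0,∞) of |y_γ(t) − y*_u(t)| tends to 0 as γ → ∞. -/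

import Mathlib

open MeasureTheory Set

/-- The variation function `ρ_u(t) = ∫₀ᵗ |u̇(τ)| dτ`. -/
noncomputable def variation (du : ℝ → ℝ) (t : ℝ) : ℝ := ∫ τ in (0:ℝ)..t, |du τ|

/-- The composition of a Lipschitz function with an absolutely continuous function is absolutely
continuous. -/
theorem LipschitzOnWith.comp_absolutelyContinuousOnInterval {φ B : ℝ → ℝ} {K : NNReal} {s : Set ℝ}
    {a b : ℝ} (hφ : LipschitzOnWith K φ s) (hB : AbsolutelyContinuousOnInterval B a b)
    (hmaps : MapsTo B (uIcc a b) s) :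
    AbsolutelyContinuousOnInterval (fun x ↦ φ (B x)) a b := by
  rw [absolutelyContinuousOnInterval_iff] at hB ⊢
  intro ε hε
  obtain ⟨δ, hδ, h⟩ := hB (ε / (K + 1)) (by positivity)
  refine ⟨δ, hδ, fun E hE hlt ↦ ?_⟩
  have hsum := h E hE hlt
  have hmem : ∀ i ∈ Finset.range E.1, (E.2 i).1 ∈ uIcc a b ∧ (E.2 i).2 ∈ uIcc a b := hE.1
  calc ∑ i ∈ Finset.range E.1, dist (φ (B (E.2 i).1)) (φ (B (E.2 i).2))
      ≤ ∑ i ∈ Finset.range E.1, K * dist (B (E.2 i).1) (B (E.2 i).2) :=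
        Finset.sum_le_sum fun i hi ↦
          hφ.dist_le_mul _ (hmaps (hmem i hi).1) _ (hmaps (hmem i hi).2)
    _ = K * ∑ i ∈ Finset.range E.1, dist (B (E.2 i).1) (B (E.2 i).2) := by rw [Finset.mul_sum]
    _ ≤ (K + 1) * ∑ i ∈ Finset.range E.1, dist (B (E.2 i).1) (B (E.2 i).2) := by
        gcongr
        linarith
    _ < (K + 1) * (ε / (K + 1)) := by gcongr
    _ = ε := by field_simp

theorem AbsolutelyContinuousOnInterval.exp {B : ℝ → ℝ} {a b : ℝ}
    (hB : AbsolutelyContinuousOnInterval B a b) :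
    AbsolutelyContinuousOnInterval (fun x ↦ Real.exp (B x)) a b := by
  obtain ⟨C, hC⟩ := hB.exists_bound
  obtain ⟨K, hK⟩ := Real.contDiff_exp.contDiffOn.exists_lipschitzOnWith (n := 1) one_ne_zero
    (convex_Icc (-C) C) isCompact_Icc
  exact hK.comp_absolutelyContinuousOnInterval hB fun x hx ↦ abs_le.1 (hC x hx)

/-- The variation of constants formula for an absolutely continuous solution of
`w' = -b w + c`, in integral form. -/
theorem exp_integral_mul_eq_add_integral {b c w : ℝ → ℝ} {w0 t : ℝ} (ht : 0 ≤ t)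
    (hb : IntervalIntegrable b volume 0 t)
    (hwint : IntervalIntegrable (fun τ ↦ -b τ * w τ + c τ) volume 0 t)
    (hw : ∀ s ∈ Icc 0 t, w s = w0 + ∫ τ in (0:ℝ)..s, (-b τ * w τ + c τ)) :
    Real.exp (∫ τ in (0:ℝ)..t, b τ) * w t
      = w0 + ∫ τ in (0:ℝ)..t, Real.exp (∫ r in (0:ℝ)..τ, b r) * c τ := by
  have h0 : (0:ℝ) ∈ uIcc 0 t := left_mem_uIcc
  have hF := (hb.absolutelyContinuousOnInterval_intervalIntegral h0).exp
  have hW : AbsolutelyContinuousOnInterval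
      (fun s ↦ w0 + ∫ τ in (0:ℝ)..s, (-b τ * w τ + c τ)) 0 t :=
    AbsolutelyContinuousOnInterval.fun_add
      (LipschitzWith.const w0).lipschitzOnWith.absolutelyContinuousOnInterval
      (hwint.absolutelyContinuousOnInterval_intervalIntegral h0)
  have hparts := hF.integral_deriv_mul_eq_sub hW
  have hcongr : ∫ τ in (0:ℝ)..t, Real.exp (∫ r in (0:ℝ)..τ, b r) * c τ
      = ∫ x in (0:ℝ)..t,
        deriv (fun x ↦ Real.exp (∫ v in (0:ℝ)..x, b v)) x
            * (w0 + ∫ τ in (0:ℝ)..x, (-b τ * w τ + c τ))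
          + Real.exp (∫ v in (0:ℝ)..x, b v)
            * deriv (fun s ↦ w0 + ∫ τ in (0:ℝ)..s, (-b τ * w τ + c τ)) x := by
    apply intervalIntegral.integral_congr_ae
    filter_upwards [hb.ae_hasDerivAt_integral, hwint.ae_hasDerivAt_integral] with x hx hx' hxt
    have hxm : x ∈ uIcc 0 t := uIoc_subset_uIcc hxt
    rw [(hx hxm 0 h0).exp.deriv, ((hx' hxm 0 h0).const_add w0).deriv,
      ← hw x (by rwa [uIcc_of_le ht] at hxm)]
    ring
  rw [hcongr, hparts, ← hw t ⟨ht, le_rfl⟩]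
  simp

/-- If `|c| ≤ K b`, then the integral term of the variation of constants formula is at most
`K (exp (∫ b) - 1)`. -/
theorem abs_integral_exp_integral_mul_le {b c : ℝ → ℝ} {K t : ℝ} (ht : 0 ≤ t)
    (hb : IntervalIntegrable b volume 0 t)
    (hc : ∀ᵐ τ ∂volume.restrict (Ici 0), |c τ| ≤ K * b τ) :
    |∫ τ in (0:ℝ)..t, Real.exp (∫ r in (0:ℝ)..τ, b r) * c τ|
      ≤ K * (Real.exp (∫ τ in (0:ℝ)..t, b τ) - 1) := by
  have hone : Real.exp (∫ τ in (0:ℝ)..t, b τ)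
      = 1 + ∫ τ in (0:ℝ)..t, Real.exp (∫ r in (0:ℝ)..τ, b r) * b τ := by
    simpa using exp_integral_mul_eq_add_integral (w := fun _ ↦ 1) (w0 := 1) (c := b) ht hb
      (by simp) (by simp)
  have hcont : ContinuousOn (fun τ ↦ Real.exp (∫ r in (0:ℝ)..τ, b r)) (uIcc 0 t) :=
    (hb.absolutelyContinuousOnInterval_intervalIntegral left_mem_uIcc).exp.continuousOn
  rw [hone, add_sub_cancel_left, ← intervalIntegral.integral_const_mul, ← Real.norm_eq_abs]
  refine intervalIntegral.norm_integral_le_of_norm_le ht ?_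
    ((hb.continuousOn_mul hcont).const_mul K)
  filter_upwards [(ae_restrict_iff' measurableSet_Ici).1 hc] with τ hτ hτt
  rw [norm_mul, Real.norm_eq_abs, Real.norm_eq_abs, Real.abs_exp]
  have := mul_le_mul_of_nonneg_left (hτ hτt.1.le) (Real.exp_pos (∫ r in (0:ℝ)..τ, b r)).le
  linarith

theorem abs_le_of_integral_eq {b c w : ℝ → ℝ} {w0 K t : ℝ} (ht : 0 ≤ t)
    (hb : IntervalIntegrable b volume 0 t)
    (hwint : IntervalIntegrable (fun τ ↦ -b τ * w τ + c τ) volume 0 t)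
    (hw : ∀ s ∈ Icc 0 t, w s = w0 + ∫ τ in (0:ℝ)..s, (-b τ * w τ + c τ))
    (hc : ∀ᵐ τ ∂volume.restrict (Ici 0), |c τ| ≤ K * b τ) (hw0 : |w0| ≤ K) :
    |w t| ≤ K := by
  have h1 := exp_integral_mul_eq_add_integral ht hb hwint hw
  have h2 := abs_integral_exp_integral_mul_le ht hb hc
  have hpos := Real.exp_pos (∫ τ in (0:ℝ)..t, b τ)
  refine le_of_mul_le_mul_left ?_ hpos
  calc Real.exp (∫ τ in (0:ℝ)..t, b τ) * |w t|
      = |Real.exp (∫ τ in (0:ℝ)..t, b τ) * w t| := by rw [abs_mul, Real.abs_exp]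
    _ ≤ |w0| + |∫ τ in (0:ℝ)..t, Real.exp (∫ r in (0:ℝ)..τ, b r) * c τ| := by
        rw [h1]
        exact abs_add_le _ _
    _ ≤ _ := by linarith

theorem intervalIntegrable_of_ae_abs_le {h : ℝ → ℝ} {C t : ℝ} (ht : 0 ≤ t)
    (hmeas : AEStronglyMeasurable h (volume.restrict (Ioc 0 t)))
    (hC : ∀ᵐ τ ∂volume.restrict (Ici 0), |h τ| ≤ C) :
    IntervalIntegrable h volume 0 t := by
  rw [intervalIntegrable_iff_integrableOn_Ioc_of_le ht]
  refine IntegrableOn.of_bound (by simp) hmeas C ?_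
  exact ae_mono (Measure.restrict_mono (fun x hx ↦ hx.1.le) le_rfl) hC

/-- A solution of `w = w₀ + ∫ (-b w + c)`, with no integrability assumed of the integrand, is
bounded by `K` as soon as `|w₀| ≤ K` and `|c| ≤ K b`; the integrand is then integrable. -/
theorem intervalIntegrable_and_abs_le_of_integral_eq {b c w : ℝ → ℝ} {w0 K Cb Cc : ℝ}
    (hbm : Measurable b) (hcm : Measurable c)
    (hbb : ∀ᵐ τ ∂volume.restrict (Ici 0), |b τ| ≤ Cb)
    (hcb : ∀ᵐ τ ∂volume.restrict (Ici 0), |c τ| ≤ Cc)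
    (hw : ∀ s, 0 ≤ s → w s = w0 + ∫ τ in (0:ℝ)..s, (-b τ * w τ + c τ))
    (hc : ∀ᵐ τ ∂volume.restrict (Ici 0), |c τ| ≤ K * b τ) (hw0 : |w0| ≤ K)
    {t : ℝ} (ht : 0 ≤ t) :
    IntervalIntegrable (fun τ ↦ -b τ * w τ + c τ) volume 0 t ∧ |w t| ≤ K := by
  have hK : 0 ≤ K := (abs_nonneg _).trans hw0
  have hundef : ∀ s, 0 ≤ s → ¬ IntervalIntegrable (fun τ ↦ -b τ * w τ + c τ) volume 0 s →
      w s = w0 := fun s hs hn ↦ by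
    rw [hw s hs, intervalIntegral.integral_undef hn, add_zero]
  have hbound : ∀ s, 0 ≤ s → |w s| ≤ K := by
    intro s hs
    by_cases hn : IntervalIntegrable (fun τ ↦ -b τ * w τ + c τ) volume 0 s
    · exact abs_le_of_integral_eq hs
        (intervalIntegrable_of_ae_abs_le hs hbm.aestronglyMeasurable hbb) hn
        (fun r hr ↦ hw r hr.1) hc hw0
    · rwa [hundef s hs hn]
  refine ⟨?_, hbound t ht⟩
  by_contra hnt
  set S : Set ℝ := {s | 0 ≤ s ∧ IntervalIntegrable (fun τ ↦ -b τ * w τ + c τ) volume 0 s}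
  have hS0 : (0:ℝ) ∈ S := ⟨le_rfl, by simp⟩
  have hSbdd : BddAbove S := ⟨t, fun s hs ↦ not_lt.1 fun hts ↦ hnt <| hs.2.mono_set <| by
    rw [uIcc_of_le ht, uIcc_of_le hs.1]
    exact Icc_subset_Icc_right hts.le⟩
  obtain ⟨v, -, hvlim, hvS⟩ := exists_seq_tendsto_sSup ⟨0, hS0⟩ hSbdd
  have hleft : AEStronglyMeasurable (fun τ ↦ -b τ * w τ + c τ)
      (volume.restrict (⋃ n, Ioc 0 (v n))) := by
    rw [aestronglyMeasurable_iUnion_iff]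
    exact fun n ↦ (hvS n).2.1.aestronglyMeasurable
  have hmid : AEStronglyMeasurable (fun τ ↦ -b τ * w τ + c τ)
      (volume.restrict {sSup S}) := by
    rw [Measure.restrict_eq_zero.2 (by simp)]
    exact aestronglyMeasurable_zero_measure _
  have hright : AEStronglyMeasurable (fun τ ↦ -b τ * w τ + c τ)
      (volume.restrict (Ioi (sSup S))) := by
    have : Measurable (fun τ ↦ -b τ * w0 + c τ) := by fun_prop
    refine this.aestronglyMeasurable.congr ?_
    filter_upwards [ae_restrict_mem measurableSet_Ioi] with τ hτ
    have hτ0 : 0 ≤ τ := (le_csSup hSbdd hS0).trans (le_of_lt hτ)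
    rw [hundef τ hτ0 fun hn ↦ not_le.2 hτ (le_csSup hSbdd ⟨hτ0, hn⟩)]
  refine hnt (intervalIntegrable_of_ae_abs_le (C := Cb * K + Cc) ht ?_ ?_)
  · refine (aestronglyMeasurable_union_iff.2
      ⟨aestronglyMeasurable_union_iff.2 ⟨hleft, hmid⟩, hright⟩).mono_set fun x hx ↦ ?_
    rcases lt_trichotomy x (sSup S) with h | h | h
    · obtain ⟨n, hn⟩ := (hvlim.eventually (lt_mem_nhds h)).exists
      exact Or.inl (Or.inl (mem_iUnion.2 ⟨n, hx.1, hn.le⟩))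
    · exact Or.inl (Or.inr h)
    · exact Or.inr h
  · filter_upwards [hbb, hcb, ae_restrict_mem measurableSet_Ici] with τ h1 h2 hτ
    have h3 := hbound τ hτ
    calc |-b τ * w τ + c τ| ≤ |b τ| * |w τ| + |c τ| := by
          simpa [abs_mul] using abs_add_le (-b τ * w τ) (c τ)
      _ ≤ Cb * K + Cc := by
          have := (abs_nonneg _).trans h1
          gcongr

/-- Two linear equations `w' = -b w + c` and `v' = -b' v + c` with the same initial value:
if `|b' - b| ≤ η b'` and `|w| ≤ M`, then `|w - v| ≤ η M`, where `v` is given by the variation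
of constants formula. -/
theorem abs_sub_exp_neg_integral_mul_le {b b' c w : ℝ → ℝ} {w0 η M t : ℝ} (ht : 0 ≤ t)
    (hη : 0 ≤ η) (hM : 0 ≤ M)
    (hb' : IntervalIntegrable b' volume 0 t) (hcint : IntervalIntegrable c volume 0 t)
    (hwint : IntervalIntegrable (fun τ ↦ -b τ * w τ + c τ) volume 0 t)
    (hw : ∀ s, 0 ≤ s → w s = w0 + ∫ τ in (0:ℝ)..s, (-b τ * w τ + c τ))
    (hwM : ∀ s, 0 ≤ s → |w s| ≤ M)
    (hbb' : ∀ᵐ τ ∂volume.restrict (Ici 0), |b' τ - b τ| ≤ η * b' τ) :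
    |w t - Real.exp (-∫ τ in (0:ℝ)..t, b' τ)
        * (w0 + ∫ τ in (0:ℝ)..t, Real.exp (∫ r in (0:ℝ)..τ, b' r) * c τ)| ≤ η * M := by
  have hsplit : ∀ τ, -b τ * w τ + c τ = -b' τ * w τ + (c τ + (b' τ - b τ) * w τ) :=
    fun τ ↦ by ring
  have hcont : ContinuousOn (fun τ ↦ Real.exp (∫ r in (0:ℝ)..τ, b' r)) (uIcc 0 t) :=
    (hb'.absolutelyContinuousOnInterval_intervalIntegral left_mem_uIcc).exp.continuousOn
  have hwcont : ContinuousOn w (uIcc 0 t) := by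
    refine ((hwint.absolutelyContinuousOnInterval_intervalIntegral
      left_mem_uIcc).continuousOn.const_add w0).congr fun s hs ↦ hw s ?_
    rw [uIcc_of_le ht] at hs
    exact hs.1
  have hdint : IntervalIntegrable (fun τ ↦ (b' τ - b τ) * w τ) volume 0 t := by
    refine ((hwint.sub hcint).add (hb'.mul_continuousOn hwcont)).congr ?_
    exact fun τ _ ↦ by ring
  have hrep := exp_integral_mul_eq_add_integral (b := b') (c := fun τ ↦ c τ + (b' τ - b τ) * w τ)
    (w := w) (w0 := w0) ht hb' (by simpa only [hsplit] using hwint)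
    (fun s hs ↦ by simpa only [hsplit] using hw s hs.1)
  simp only [mul_add] at hrep
  rw [intervalIntegral.integral_add (hcint.continuousOn_mul hcont)
    (hdint.continuousOn_mul hcont), ← add_assoc] at hrep
  have hle := abs_integral_exp_integral_mul_le (c := fun τ ↦ (b' τ - b τ) * w τ) (K := η * M)
    ht hb' (by
      filter_upwards [hbb', ae_restrict_mem measurableSet_Ici] with τ h1 hτ
      rw [abs_mul]
      calc |b' τ - b τ| * |w τ| ≤ η * b' τ * M :=
            mul_le_mul h1 (hwM τ hτ) (abs_nonneg _) ((abs_nonneg _).trans h1)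
        _ = η * M * b' τ := by ring)
  set E := Real.exp (∫ τ in (0:ℝ)..t, b' τ) with hE
  have hEpos : 0 < E := Real.exp_pos _
  rw [Real.exp_neg, ← hE]
  refine le_of_mul_le_mul_left ?_ hEpos
  calc E * |w t - E⁻¹ * (w0 + ∫ τ in (0:ℝ)..t, Real.exp (∫ r in (0:ℝ)..τ, b' r) * c τ)|
      = |E * w t - (w0 + ∫ τ in (0:ℝ)..t, Real.exp (∫ r in (0:ℝ)..τ, b' r) * c τ)| := by
        rw [← abs_of_pos hEpos, ← abs_mul, abs_of_pos hEpos, mul_sub,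
          mul_inv_cancel_left₀ hEpos.ne']
    _ ≤ η * M * (E - 1) := by rwa [hrep, add_sub_cancel_left]
    _ ≤ E * (η * M) := by nlinarith [mul_nonneg hη hM]

/-- convergence of the scaled outputs `y_γ` of the LuGre model to
the limit output `y*_u` in `L^∞([0,∞))` as `γ → ∞`: for every `ε > 0` there is
`Γ` such that for all `γ ≥ Γ` the essential supremum of `|y_γ - y*_u|` over
`[0,∞)` is at most `ε`. -/
theorem lugre_scaled_output_tendsto_limit_output
    (σ0 σ1 : ℝ) (hσ0 : 0 < σ0) (hσ1 : 0 < σ1)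
    (g : ℝ → ℝ) (hg : Continuous g) (hgpos : ∀ ν : ℝ, 0 < g ν)
    (f : ℝ → ℝ) (hf : Continuous f) (hf0 : f 0 = 0)
    (u du : ℝ → ℝ)
    (hmeas : Measurable du)
    (hubdd : ∃ C : ℝ, ∀ᵐ t ∂(volume.restrict (Ici (0:ℝ))), |u t| ≤ C)
    (hdubdd : ∃ C : ℝ, ∀ᵐ t ∂(volume.restrict (Ici (0:ℝ))), |du t| ≤ C)
    (hftc : ∀ s t : ℝ, 0 ≤ s → s ≤ t → u t - u s = ∫ τ in s..t, du τ)
    (x0 : ℝ)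
    (z : ℝ → ℝ → ℝ)
    (hz : ∀ γ : ℝ, 0 < γ → ∀ t : ℝ, 0 ≤ t →
      z γ t = x0 + ∫ τ in (0:ℝ)..t,
        (-(σ0 * |du τ| / g (du τ / γ)) * z γ τ + du τ))
    (y : ℝ → ℝ → ℝ)
    (hy : ∀ γ : ℝ, 0 < γ → ∀ᵐ t ∂(volume.restrict (Ici (0:ℝ))),
      y γ t = σ0 * z γ t
        + (σ1 / γ) * (-(σ0 * |du t| / g (du t / γ)) * z γ t + du t)
        + f (du t / γ))
    (ystar : ℝ → ℝ)
    (hystar : ∀ t : ℝ, 0 ≤ t →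
      ystar t = σ0 * Real.exp (-(σ0 / g 0) * variation du t) *
        (x0 + ∫ τ in (0:ℝ)..t, Real.exp ((σ0 / g 0) * variation du τ) * du τ)) :
    ∀ ε : ℝ, 0 < ε → ∃ Γ : ℝ, ∀ γ : ℝ, Γ ≤ γ →
      ∀ᵐ t ∂(volume.restrict (Ici (0:ℝ))), |y γ t - ystar t| ≤ ε := by
  intro ε hε
  obtain ⟨C₀, hC₀⟩ := hdubdd
  obtain ⟨C, hC0, hC⟩ : ∃ C : ℝ, 0 ≤ C ∧ ∀ᵐ t ∂volume.restrict (Ici (0:ℝ)), |du t| ≤ C :=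
    ⟨max C₀ 0, le_max_right _ _, hC₀.mono fun t ht ↦ ht.trans (le_max_left _ _)⟩
  set h0 := σ0 / g 0 with hh0
  have hh0pos : 0 < h0 := div_pos hσ0 (hgpos 0)
  set M := max |x0| (2 / h0)
  have hM : 0 < M := lt_max_of_lt_right (by positivity)
  have hMh : 2 ≤ M * h0 := (div_le_iff₀ hh0pos).1 (le_max_right _ _)
  set η := min (1 / 2) (ε / (3 * (σ0 * M))) with hηdef
  have hη : 0 < η := lt_min (by norm_num) (by positivity)
  have hη2 : η ≤ 1 / 2 := min_le_left _ _
  have hηε : σ0 * (η * M) ≤ ε / 3 := by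
    have := (le_div_iff₀ (by positivity)).1 (min_le_right (1 / 2) (ε / (3 * (σ0 * M))))
    rw [← hηdef] at this
    linarith
  have hgcont : Continuous fun ν ↦ |h0 - σ0 / g ν| :=
    (continuous_const.sub (continuous_const.div hg fun ν ↦ (hgpos ν).ne')).abs
  obtain ⟨r, hr, hnear⟩ : ∃ r > 0, ∀ ν : ℝ, |ν| < r →
      |h0 - σ0 / g ν| < η * h0 ∧ |f ν| < ε / 3 := by
    have h1 : ∀ᶠ ν in nhds (0:ℝ), |h0 - σ0 / g ν| < η * h0 :=
      hgcont.continuousAt.eventually_lt continuousAt_const (by simpa [← hh0] using by positivity)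
    have h2 : ∀ᶠ ν in nhds (0:ℝ), |f ν| < ε / 3 :=
      hf.abs.continuousAt.eventually_lt continuousAt_const (by simpa [hf0] using hε)
    obtain ⟨r, hr, hr'⟩ := Metric.eventually_nhds_iff.1 (h1.and h2)
    exact ⟨r, hr, fun ν hν ↦ hr' (by simpa using hν)⟩
  set D := 2 * h0 * C * M + C
  have hD0 : 0 ≤ D := by positivity
  refine ⟨max ((C + 1) / r) (3 * σ1 * D / ε), fun γ hγ ↦ ?_⟩
  have hγ1 : C + 1 ≤ γ * r := (div_le_iff₀ hr).1 ((le_max_left _ _).trans hγ)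
  have hγ2 : 3 * σ1 * D ≤ γ * ε := (div_le_iff₀ hε).1 ((le_max_right _ _).trans hγ)
  have hγ0 : 0 < γ := pos_of_mul_pos_left (by linarith) hr.le
  have hsmall : ∀ τ, |du τ| ≤ C → |du τ / γ| < r := fun τ hτ ↦ by
    rw [abs_div, abs_of_pos hγ0, div_lt_iff₀ hγ0]
    linarith
  have hcoef : ∀ τ, σ0 * |du τ| / g (du τ / γ) = σ0 / g (du τ / γ) * |du τ| := fun τ ↦ by ring
  have hbm : Measurable fun τ ↦ σ0 * |du τ| / g (du τ / γ) := by
    have hdm : Measurable fun τ ↦ g (du τ / γ) := hg.measurable.comp (hmeas.div_const γ)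
    exact (hmeas.abs.const_mul σ0).div hdm
  have hbb : ∀ τ, |du τ| ≤ C → |σ0 * |du τ| / g (du τ / γ)| ≤ 2 * h0 * C := fun τ hτ ↦ by
    have h1 := (abs_lt.1 (hnear _ (hsmall τ hτ)).1).1
    have hpos : 0 < σ0 / g (du τ / γ) := div_pos hσ0 (hgpos _)
    rw [hcoef, abs_mul, abs_abs, abs_of_pos hpos]
    have : σ0 / g (du τ / γ) ≤ 2 * h0 := by nlinarith
    gcongr
  have hcb : ∀ τ, |du τ| ≤ C → |du τ| ≤ M * (σ0 * |du τ| / g (du τ / γ)) := fun τ hτ ↦ by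
    have h1 := (abs_lt.1 (hnear _ (hsmall τ hτ)).1).2
    have : 1 ≤ M * (σ0 / g (du τ / γ)) := by
      have : h0 / 2 ≤ σ0 / g (du τ / γ) := by nlinarith
      nlinarith
    rw [hcoef, ← mul_assoc]
    exact le_mul_of_one_le_left (abs_nonneg _) this
  have hz' := fun t (ht : 0 ≤ t) ↦ intervalIntegrable_and_abs_le_of_integral_eq hbm hmeas
    (hC.mono hbb) hC (hz γ hγ0) (hC.mono hcb) (le_max_left _ _) ht
  have hdiff : ∀ τ, |du τ| ≤ C →
      |h0 * |du τ| - σ0 * |du τ| / g (du τ / γ)| ≤ η * (h0 * |du τ|) := fun τ hτ ↦ by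
    rw [hcoef, ← sub_mul, abs_mul, abs_abs, ← mul_assoc]
    exact mul_le_mul_of_nonneg_right (hnear _ (hsmall τ hτ)).1.le (abs_nonneg _)
  filter_upwards [hy γ hγ0, hC, ae_restrict_mem measurableSet_Ici] with t hyt hCt ht
  have hduint : IntervalIntegrable du volume 0 t :=
    intervalIntegrable_of_ae_abs_le ht hmeas.aestronglyMeasurable hC
  have hmain := abs_sub_exp_neg_integral_mul_le ht hη.le hM.le (hduint.abs.const_mul h0) hduint
    (hz' t ht).1 (hz γ hγ0) (fun s hs ↦ (hz' s hs).2) (hC.mono hdiff)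
  simp only [intervalIntegral.integral_const_mul, ← neg_mul] at hmain
  simp only [variation] at hystar
  have hzt := (hz' t ht).2
  have hrate : |-(σ0 * |du t| / g (du t / γ)) * z γ t + du t| ≤ D := by
    calc |-(σ0 * |du t| / g (du t / γ)) * z γ t + du t|
        ≤ |σ0 * |du t| / g (du t / γ)| * |z γ t| + |du t| := by
          simpa only [abs_mul, abs_neg] using
            abs_add_le (-(σ0 * |du t| / g (du t / γ)) * z γ t) (du t)
      _ ≤ 2 * h0 * C * M + C := by
          gcongr
          exact hbb t hCt
  have hdamp : |σ1 / γ * (-(σ0 * |du t| / g (du t / γ)) * z γ t + du t)| ≤ ε / 3 := by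
    rw [abs_mul, abs_of_pos (div_pos hσ1 hγ0)]
    calc σ1 / γ * |-(σ0 * |du t| / g (du t / γ)) * z γ t + du t| ≤ σ1 / γ * D := by gcongr
      _ ≤ ε / 3 := by
          rw [div_mul_eq_mul_div, div_le_iff₀ hγ0]
          linarith
  have hstate := (mul_le_mul_of_nonneg_left hmain hσ0.le).trans hηε
  rw [← abs_of_pos hσ0, ← abs_mul, mul_sub, ← mul_assoc, ← hystar t ht] at hstate
  have hfric := (hnear _ (hsmall t hCt)).2
  rw [hyt]
  rw [abs_le] at hstate hdamp ⊢
  rw [abs_lt] at hfric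
  constructor <;> linarith
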